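/- Suppose f : ℝ → ℝ solves the safe-integration equation for (g₀, h₀, h₁). Then for every n ∈ ℕ, f(2n+1) = h₁(n, f(n)). -/

import Mathlib

noncomputable def parity (x : ℝ) : ℝ := max 0 (Real.pi / 2 * Real.sin (Real.pi * x))

noncomputable def pfun (x : ℝ) : ℝ := ∫ t in (0:ℝ)..(x - 1), parity t

noncomputable def pfun' (x : ℝ) : ℝ := pfun (x - 1) + 1

def SolvesSafeIntegration (g0 : ℝ) (h0 h1 : ℝ → ℝ → ℝ) (f : ℝ → ℝ) : Prop :=
  f 0 = g0 ∧ ∀ x : ℝ, HasDerivAt f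
    (parity x * (h1 (pfun x) (f (pfun x)) - f (2 * pfun x)) +
     parity (x - 1) * (h0 (pfun' x) (f (pfun' x)) - f (2 * pfun' x - 1))) x

theorem parity_continuous : Continuous parity := by
  unfold parity
  fun_prop

theorem parity_periodic : Function.Periodic parity 2 := by
  intro x
  unfold parity
  rw [show Real.pi * (x + 2) = Real.pi * x + 2 * Real.pi by ring, Real.sin_add_two_pi]

theorem parity_of_mem_Icc_zero_one {x : ℝ} (hx : x ∈ Set.Icc (0 : ℝ) 1) :
    parity x = Real.pi / 2 * Real.sin (Real.pi * x) := by
  have hpi := Real.pi_pos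
  have hsin : 0 ≤ Real.sin (Real.pi * x) :=
    Real.sin_nonneg_of_nonneg_of_le_pi (mul_nonneg hpi.le hx.1) (by nlinarith [hx.2])
  exact max_eq_right (by positivity)

theorem parity_of_mem_Icc_neg_one_zero {x : ℝ} (hx : x ∈ Set.Icc (-1 : ℝ) 0) :
    parity x = 0 := by
  have hpi := Real.pi_pos
  have hsin : Real.sin (Real.pi * x) ≤ 0 :=
    Real.sin_nonpos_of_nonpos_of_neg_pi_le (by nlinarith [hx.2]) (by nlinarith [hx.1])
  exact max_eq_left (mul_nonpos_of_nonneg_of_nonpos (by positivity) hsin)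

theorem parity_add_two_mul_nat (x : ℝ) (n : ℕ) : parity (x + 2 * n) = parity x := by
  rw [mul_comm]
  exact parity_periodic.nat_mul n x

theorem integral_parity_zero_one : ∫ t in (0 : ℝ)..1, parity t = 1 := by
  have hpi := Real.pi_ne_zero
  have hcongr : ∫ t in (0 : ℝ)..1, parity t =
      ∫ t in (0 : ℝ)..1, Real.pi / 2 * Real.sin (Real.pi * t) := by
    refine intervalIntegral.integral_congr fun t ht => parity_of_mem_Icc_zero_one ?_
    rwa [Set.uIcc_of_le zero_le_one] at ht
  rw [hcongr, intervalIntegral.integral_const_mul,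
    intervalIntegral.integral_comp_mul_left _ hpi]
  simp only [mul_zero, mul_one, integral_sin, Real.cos_zero, Real.cos_pi, smul_eq_mul]
  field_simp
  norm_num

theorem integral_parity_eq_zero {a b : ℝ} (ha : a ∈ Set.Icc (-1 : ℝ) 0)
    (hb : b ∈ Set.Icc (-1 : ℝ) 0) : ∫ t in a..b, parity t = 0 := by
  rw [intervalIntegral.integral_congr (g := fun _ => (0 : ℝ)) fun t ht =>
    parity_of_mem_Icc_neg_one_zero (Set.uIcc_subset_Icc ha hb ht)]
  exact intervalIntegral.integral_zero

theorem integral_parity_add_two_mul_nat (a b : ℝ) (n : ℕ) :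
    ∫ t in (a + 2 * n)..(b + 2 * n), parity t = ∫ t in a..b, parity t := by
  rw [← intervalIntegral.integral_comp_add_right]
  simp only [parity_add_two_mul_nat]

theorem integral_parity_zero_two_mul_nat (n : ℕ) :
    ∫ t in (0 : ℝ)..2 * n, parity t = n := by
  have hint (a b : ℝ) : IntervalIntegrable parity MeasureTheory.volume a b :=
    parity_continuous.intervalIntegrable a b
  induction n with
  | zero => simp
  | succ n ih =>
    have hone : ∫ t in (1 : ℝ)..2, parity t = 0 := by
      have h := integral_parity_add_two_mul_nat (-1) 0 1
      rw [integral_parity_eq_zero (a := -1) (b := 0) (by norm_num) (by norm_num)] at h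
      norm_num at h
      exact h
    have hstep := integral_parity_add_two_mul_nat 0 2 n
    rw [← intervalIntegral.integral_add_adjacent_intervals (hint 0 1) (hint 1 2),
      integral_parity_zero_one, hone, add_zero, zero_add] at hstep
    rw [show (2 * ((n + 1 : ℕ) : ℝ)) = 2 + 2 * n by push_cast; ring,
      ← intervalIntegral.integral_add_adjacent_intervals (hint 0 (2 * n)) (hint _ _), ih, hstep]
    push_cast
    rfl

theorem pfun_add_two_mul_nat {y : ℝ} (hy : y ∈ Set.Icc (0 : ℝ) 1) (n : ℕ) :
    pfun (y + 2 * n) = n := by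
  have hint (a b : ℝ) : IntervalIntegrable parity MeasureTheory.volume a b :=
    parity_continuous.intervalIntegrable a b
  have hshift := integral_parity_add_two_mul_nat 0 (y - 1) n
  rw [integral_parity_eq_zero (a := 0) (b := y - 1) (by norm_num)
      ⟨by linarith [hy.1], by linarith [hy.2]⟩,
    zero_add] at hshift
  unfold pfun
  rw [show y + 2 * (n : ℝ) - 1 = y - 1 + 2 * n by ring,
    ← intervalIntegral.integral_add_adjacent_intervals (hint 0 (2 * n)) (hint _ _),
    integral_parity_zero_two_mul_nat, hshift, add_zero]

theorem safe_integration_odd_value (g0 : ℝ) (h0 h1 : ℝ → ℝ → ℝ) (f : ℝ → ℝ)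
    (hf : SolvesSafeIntegration g0 h0 h1 f) :
    ∀ n : ℕ, f (2*n + 1) = h1 n (f n) := by
  intro n
  have hderiv : ∀ x ∈ Set.uIcc (0 + 2 * n : ℝ) (1 + 2 * n),
      HasDerivAt f (parity x * (h1 n (f n) - f (2 * n))) x := by
    intro x hx
    rw [Set.uIcc_of_le (by linarith)] at hx
    have hy : x - 2 * n ∈ Set.Icc (0 : ℝ) 1 := ⟨by linarith [hx.1], by linarith [hx.2]⟩
    have hp : pfun x = n := by simpa using pfun_add_two_mul_nat hy n
    have hzero : parity (x - 1) = 0 := by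
      rw [show x - 1 = x - 2 * n - 1 + 2 * n by ring, parity_add_two_mul_nat]
      exact parity_of_mem_Icc_neg_one_zero ⟨by linarith [hy.1], by linarith [hy.2]⟩
    simpa [hp, hzero] using hf.2 x
  have hFTC := intervalIntegral.integral_eq_sub_of_hasDerivAt hderiv
    ((parity_continuous.mul continuous_const).intervalIntegrable _ _)
  rw [intervalIntegral.integral_mul_const, integral_parity_add_two_mul_nat,
    integral_parity_zero_one, zero_add, add_comm (1 : ℝ)] at hFTC
  linarith
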